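/- arXiv:1804.03953 — 2 statements merged into one kernel-verified Lean document; each statement's English description precedes it below -/
import Mathlib

section
/- Let P be a convex body in R^d whose maximal-volume inscribed ellipsoid is the unit ball B(c,1) centered at c. Then P is contained in the ball B(c,d) of radius d centered at c. -/
/-- A set is an ellipsoid if it is the image of the closed unit ball under an
invertible affine transformation. -/
def IsEllipsoid {d : ℕ} (A : Set (EuclideanSpace ℝ (Fin d))) : Prop :=
  ∃ f : EuclideanSpace ℝ (Fin d) ≃ᵃ[ℝ] EuclideanSpace ℝ (Fin d),
    A = f '' Metric.closedBall 0 1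

lemma john_ineq {t s a b W w M : ℝ} (ht : 1 < t) (hs : 0 < s) (hs1 : s ≤ 1)
    (ha : a = 1 + s) (hb : b ^ 2 = 1 - 2 * s / (t - 1)) (hwW : |w| ≤ W) (hWM : W ≤ M)
    (hb0 : 0 < b) (htw : t * w ≤ M) :
    s * w + √(a ^ 2 * w ^ 2 + b ^ 2 * (W ^ 2 - w ^ 2)) ≤ M := by
  have hw := abs_le.1 hwW
  have hW0 : 0 ≤ W := (abs_nonneg w).trans hwW
  have h1 : 0 ≤ M - s * w := by nlinarith
  have ht1 : 0 < t - 1 := by linarith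
  have h2 : a ^ 2 * w ^ 2 + b ^ 2 * (W ^ 2 - w ^ 2) ≤ (M - s * w) ^ 2 := by
    have h3 : b ^ 2 * W ^ 2 ≤ b ^ 2 * M ^ 2 := by gcongr
    have h4 : 0 ≤ 2 * s / (t - 1) * ((M - t * w) * (M + w)) := by
      apply mul_nonneg (by positivity)
      apply mul_nonneg <;> linarith
    have h5 : (M - s * w) ^ 2 - (a ^ 2 * w ^ 2 + b ^ 2 * (M ^ 2 - w ^ 2))
        = 2 * s / (t - 1) * ((M - t * w) * (M + w)) := by
      rw [ha, hb]; field_simp; ring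
    linarith
  have := Real.sqrt_le_sqrt h2
  rw [Real.sqrt_sq h1] at this
  linarith

lemma john_params {d : ℕ} (hd : 1 ≤ d) {t : ℝ} (ht : (d : ℝ) < t) :
    ∃ s b : ℝ, 0 < s ∧ s ≤ 1 ∧ 0 < b ∧ b ^ 2 = 1 - 2 * s / (t - 1) ∧
      1 < (1 + s) * b ^ (d - 1) := by
  obtain ⟨n, rfl⟩ : ∃ n, d = n + 1 := ⟨d - 1, by omega⟩
  push_cast at ht
  have hn : (0 : ℝ) ≤ n := n.cast_nonneg
  have ht1 : 0 < t - 1 := by linarith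
  set q : ℝ := n / (t - 1) with hq
  have hq0 : 0 ≤ q := by positivity
  have hq1 : q < 1 := by rw [hq, div_lt_one ht1]; linarith
  set s : ℝ := min ((1 - q) / 4) ((t - 1) / 4) with hs
  have hsa : s ≤ (1 - q) / 4 := min_le_left _ _
  have hsb : s ≤ (t - 1) / 4 := min_le_right _ _
  have hs0 : 0 < s := lt_min (by linarith) (by linarith)
  have hx : 2 * s / (t - 1) ≤ 1 / 2 := by rw [div_le_iff₀ ht1]; linarith
  refine ⟨s, √(1 - 2 * s / (t - 1)), hs0, by linarith, Real.sqrt_pos.2 (by linarith),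
    Real.sq_sqrt (by linarith), ?_⟩
  set b := √(1 - 2 * s / (t - 1)) with hb
  have hb0 : 0 < b := Real.sqrt_pos.2 (by linarith)
  have hb2 : b ^ 2 = 1 - 2 * s / (t - 1) := Real.sq_sqrt (by linarith)
  have hber := one_add_mul_le_pow (a := -(2 * s / (t - 1))) (by linarith) n
  have e1 : 1 + (n : ℝ) * -(2 * s / (t - 1)) = 1 - 2 * q * s := by rw [hq]; ring
  have e2 : (1 + -(2 * s / (t - 1))) ^ n = (b ^ n) ^ 2 := by
    rw [← pow_mul, mul_comm n 2, pow_mul, hb2]; ring_nf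
  rw [e1, e2] at hber
  have key : 1 < ((1 + s) * b ^ n) ^ 2 := by
    have h1 : 1 < (1 + 2 * s) * (1 - 2 * q * s) := by
      have : 0 < s * (1 - q - 2 * q * s) := mul_pos hs0 (by nlinarith)
      nlinarith
    have h2 : (1 + 2 * s) * (1 - 2 * q * s) ≤ (1 + 2 * s) * (b ^ n) ^ 2 := by gcongr
    have h3 : (1 + 2 * s) * (b ^ n) ^ 2 ≤ (1 + s) ^ 2 * (b ^ n) ^ 2 := by
      gcongr; nlinarith
    rw [mul_pow]; linarith
  simp only [Nat.add_sub_cancel]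
  have hp : 0 ≤ (1 + s) * b ^ n := by positivity
  nlinarith

/-- John's theorem (Ball's refinement, non-symmetric case): if the maximal-volume
ellipsoid inscribed in a convex body `P ⊆ ℝ^d` is the unit ball `B(c,1)`, then
`P ⊆ B(c,d)`. -/
theorem stmt8 {d : ℕ} (P : Set (EuclideanSpace ℝ (Fin d)))
    (hPconv : Convex ℝ P) (hPcomp : IsCompact P) (hPint : (interior P).Nonempty)
    (c : EuclideanSpace ℝ (Fin d))
    (hball : Metric.closedBall c 1 ⊆ P)
    (hmax : ∀ A : Set (EuclideanSpace ℝ (Fin d)), IsEllipsoid A → A ⊆ P →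
      MeasureTheory.volume A ≤ MeasureTheory.volume (Metric.closedBall c 1)) :
    P ⊆ Metric.closedBall c d := by
  intro x hx
  rw [Metric.mem_closedBall, dist_eq_norm]
  by_contra! hlt
  have hd : 1 ≤ d := by
    rcases Nat.eq_zero_or_pos d with rfl | h
    · have : x = c := Subsingleton.elim _ _
      simp [this] at hlt
    · exact h
  set t := ‖x - c‖ with ht
  have hd' : (1 : ℝ) ≤ d := by exact_mod_cast hd
  have ht1 : 1 < t := by linarith
  obtain ⟨s, b, hs0, hs1, hb0, hb2, hdet⟩ := john_params hd hlt
  set a : ℝ := 1 + s with ha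
  set e : EuclideanSpace ℝ (Fin d) := t⁻¹ • (x - c) with he
  have hte : x = c + t • e := by
    rw [he, smul_smul, mul_inv_cancel₀ (by linarith), one_smul]; abel
  have hen : ‖e‖ = 1 := by
    rw [he, norm_smul, ← ht, norm_inv, Real.norm_of_nonneg (by linarith),
      inv_mul_cancel₀ (by linarith)]
  have hee : inner ℝ e e = (1 : ℝ) := by rw [real_inner_self_eq_norm_sq, hen]; norm_num
  clear_value e
  let T : EuclideanSpace ℝ (Fin d) →ₗ[ℝ] EuclideanSpace ℝ (Fin d) :=
    b • LinearMap.transvection ((a / b - 1) • (innerSL ℝ e).toLinearMap) e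
  have hT : ∀ v, T v = b • v + ((a - b) * inner ℝ e v) • e := by
    intro v
    simp only [T, LinearMap.smul_apply, LinearMap.transvection.apply, smul_add, smul_smul]
    congr 2
    simp
    field_simp
  have hTdet : LinearMap.det T = a * b ^ (d - 1) := by
    simp only [T, LinearMap.det_smul, LinearMap.transvection.det]
    obtain ⟨n, rfl⟩ : ∃ n, d = n + 1 := ⟨d - 1, by omega⟩
    simp [hen]
    field_simp
    ring
  have hdet0 : LinearMap.det T ≠ 0 := by rw [hTdet]; positivity
  let f : EuclideanSpace ℝ (Fin d) ≃ᵃ[ℝ] EuclideanSpace ℝ (Fin d) :=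
    (T.equivOfDetNeZero hdet0).toAffineEquiv.trans
      (AffineEquiv.constVAdd ℝ _ (c + s • e))
  have hf : ∀ v, f v = (c + s • e) + T v := fun v => rfl
  have hsub : f '' Metric.closedBall 0 1 ⊆ P := by
    rintro _ ⟨v, hv, rfl⟩
    rw [hf]
    by_contra hy
    obtain ⟨g, u, hg, hu⟩ := geometric_hahn_banach_closed_point hPconv hPcomp.isClosed hy
    obtain ⟨w, rfl⟩ := (InnerProductSpace.toDual ℝ (EuclideanSpace ℝ (Fin d))).surjective g
    simp only [InnerProductSpace.toDual_apply_apply] at hg hu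
    have h1 : t * inner ℝ e w ≤ u - inner ℝ w c := by
      have := hg x hx
      rw [hte, inner_add_right, inner_smul_right, real_inner_comm e w] at this
      linarith
    have h2 : ‖w‖ ≤ u - inner ℝ w c := by
      have := hg (c + ‖w‖⁻¹ • w) (hball (by
        rw [Metric.mem_closedBall, dist_eq_norm, add_sub_cancel_left, norm_smul, norm_inv,
          norm_norm]
        exact inv_mul_le_one))
      rw [inner_add_right, inner_smul_right, real_inner_self_eq_norm_sq] at this
      have h3 : ‖w‖⁻¹ * ‖w‖ ^ 2 = ‖w‖ := by
        by_cases h : ‖w‖ = 0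
        · simp [h]
        · field_simp
      linarith
    have h3 : |inner ℝ e w| ≤ ‖w‖ := by
      have := abs_real_inner_le_norm e w
      rwa [hen, one_mul] at this
    have h4 := john_ineq ht1 hs0 hs1 ha hb2 h3 h2 hb0 h1
    have h5 : inner ℝ w (T v) ≤ √(a ^ 2 * (inner ℝ e w) ^ 2 + b ^ 2 * (‖w‖ ^ 2 - (inner ℝ e w) ^ 2)) := by
      have e1 : inner ℝ w (T v) = inner ℝ (T w) v := by
        rw [hT, hT, inner_add_right, inner_add_left, inner_smul_right, inner_smul_right,
          real_inner_smul_left, real_inner_smul_left, real_inner_comm e w]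
        ring
      have e2 : ‖T w‖ ^ 2 = a ^ 2 * (inner ℝ e w) ^ 2 + b ^ 2 * (‖w‖ ^ 2 - (inner ℝ e w) ^ 2) := by
        rw [hT, norm_add_sq_real, norm_smul, norm_smul, hen, real_inner_smul_left,
          inner_smul_right, real_inner_comm e w, mul_pow, mul_pow, Real.norm_eq_abs,
          Real.norm_eq_abs, sq_abs, sq_abs]
        ring
      rw [e1, ← e2, Real.sqrt_sq (norm_nonneg _)]
      have hv1 : ‖v‖ ≤ 1 := by simpa using hv
      calc _ ≤ ‖T w‖ * ‖v‖ := real_inner_le_norm _ _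
        _ ≤ ‖T w‖ * 1 := by gcongr
        _ = _ := mul_one _
    rw [inner_add_right, inner_add_right, inner_smul_right, real_inner_comm e w] at hu
    linarith
  have hvol := hmax _ ⟨f, rfl⟩ hsub
  have himg : f '' Metric.closedBall 0 1 =
      (fun y => (c + s • e) + y) '' (T '' Metric.closedBall 0 1) := by
    rw [Set.image_image]; rfl
  rw [himg, Set.image_add_left, MeasureTheory.measure_preimage_add,
    MeasureTheory.Measure.addHaar_image_linearMap, hTdet,
    MeasureTheory.Measure.addHaar_closedBall_center _ c 1] at hvol
  have hpos : MeasureTheory.volume (Metric.closedBall (0 : EuclideanSpace ℝ (Fin d)) 1) ≠ 0 :=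
    (Metric.measure_closedBall_pos _ _ one_pos).ne'
  have hfin : MeasureTheory.volume (Metric.closedBall (0 : EuclideanSpace ℝ (Fin d)) 1) ≠ ⊤ :=
    MeasureTheory.measure_closedBall_lt_top.ne
  have h1 : (1 : ENNReal) < ENNReal.ofReal |a * b ^ (d - 1)| := by
    rw [← ENNReal.ofReal_one]
    exact (ENNReal.ofReal_lt_ofReal_iff (by positivity)).2 (hdet.trans_le (le_abs_self _))
  have h2 := ENNReal.mul_lt_mul_left hpos hfin h1
  rw [one_mul] at h2
  exact absurd hvol (not_le.2 h2)
end

section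
/- For any convex body P in R^d there exists a point c ∈ P and an invertible affine transformation F : R^d → R^d such that the maximal-volume ellipsoid contained in F(P) is the unit ball B(c,1), and F(P) ⊆ B(c,d). -/
lemma le_of_sq_le_sq_aux {x y : ℝ} (h : x ^ 2 ≤ y ^ 2) (hy : 0 ≤ y) : x ≤ y :=
  le_of_abs_le (by simpa [abs_of_nonneg hy] using sq_le_sq.mp h)

/-- The key real inequality. -/
lemma john_real (s t N y b2 S : ℝ) (hs : 1 < s) (ht0 : 0 < t) (ht1 : t ≤ 1)
    (hts : 2 * t < s - 1) (hb : b2 = 1 - 2 * t / (s - 1)) (hy : |y| ≤ N)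
    (hS0 : 0 ≤ S) (hS : S ^ 2 = b2 * N ^ 2 + ((1 + t) ^ 2 - b2) * y ^ 2) :
    t * y + S ≤ max N (s * y) := by
  have hs1 : 0 < s - 1 := by linarith
  obtain ⟨hy1, hy2⟩ := abs_le.mp hy
  have hk : b2 * (s - 1) = s - 1 - 2 * t := by
    rw [hb]; field_simp
  have hbpos : 0 < b2 := by
    by_contra h
    push Not at h
    nlinarith
  rcases le_total (s * y) N with h | h
  · refine le_trans ?_ (le_max_left _ _)
    have h1 : S ≤ N - t * y := by
      refine le_of_sq_le_sq_aux ?_ (by nlinarith [abs_nonneg y])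
      rw [hS]
      have e : (s - 1) * ((N - t * y) ^ 2 - (b2 * N ^ 2 + ((1 + t) ^ 2 - b2) * y ^ 2))
          = 2 * t * ((N + y) * (N - s * y)) := by
        linear_combination (y ^ 2 - N ^ 2) * hk
      have : 0 ≤ (s - 1) * ((N - t * y) ^ 2 - (b2 * N ^ 2 + ((1 + t) ^ 2 - b2) * y ^ 2)) := by
        rw [e]
        have : 0 ≤ (N + y) * (N - s * y) := mul_nonneg (by linarith) (by linarith)
        positivity
      have := nonneg_of_mul_nonneg_right this hs1
      linarith
    linarith
  · refine le_trans ?_ (le_max_right _ _)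
    have hN : 0 ≤ N := le_trans (abs_nonneg y) hy
    have hy0 : 0 ≤ y := by
      by_contra hh
      push Not at hh
      nlinarith
    have h1 : S ≤ (s - t) * y := by
      refine le_of_sq_le_sq_aux ?_ (mul_nonneg (by linarith) hy0)
      rw [hS]
      have e : ((s - t) * y) ^ 2 - (b2 * N ^ 2 + ((1 + t) ^ 2 - b2) * y ^ 2)
          = b2 * ((s * y - N) * (s * y + N)) := by
        linear_combination (-(s + 1) * y ^ 2) * hk
      have : 0 ≤ b2 * ((s * y - N) * (s * y + N)) :=
        mul_nonneg hbpos.le (mul_nonneg (by linarith) (by nlinarith))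
      linarith
    linarith

lemma john_choose_t (d : ℕ) (s : ℝ) (hd : 1 ≤ d) (hs : (d : ℝ) < s) :
    ∃ t : ℝ, 0 < t ∧ t ≤ 1 ∧ 2 * t < s - 1 ∧
      1 < (1 + t) ^ 2 * (1 - 2 * t / (s - 1)) ^ (d - 1) := by
  have hd' : (1 : ℝ) ≤ d := by exact_mod_cast hd
  have hs1 : 0 < s - 1 := by linarith
  obtain ⟨n, rfl⟩ : ∃ n, d = n + 1 := ⟨d - 1, by omega⟩
  push_cast at hs
  set k : ℝ := n / (s - 1) with hk
  have hk0 : 0 ≤ k := by positivity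
  have hk1 : k < 1 := by rw [hk, div_lt_one hs1]; linarith
  refine ⟨min ((1 - k) / 6) ((s - 1) / 4), lt_min (by linarith) (by linarith), ?_, ?_, ?_⟩
  · exact le_trans (min_le_left _ _) (by linarith)
  · have := min_le_right ((1 - k) / 6) ((s - 1) / 4)
    linarith
  · set t := min ((1 - k) / 6) ((s - 1) / 4) with ht
    have ht0 : 0 < t := lt_min (by linarith) (by linarith)
    have ht1 : t ≤ (1 - k) / 6 := min_le_left _ _
    have ht2 : t ≤ (s - 1) / 4 := min_le_right _ _
    have hx : 2 * t / (s - 1) ≤ 1 := by rw [div_le_one hs1]; linarith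
    have hb := one_add_mul_le_pow (a := -(2 * t / (s - 1))) (by linarith) n
    have e : 1 + (n : ℝ) * -(2 * t / (s - 1)) = 1 - 2 * k * t := by
      rw [hk]; ring
    rw [e, ← sub_eq_add_neg] at hb
    simp only [Nat.add_sub_cancel]
    have h3 : (1 + t) ^ 2 * (1 - 2 * k * t) ≤ (1 + t) ^ 2 * (1 - 2 * t / (s - 1)) ^ n :=
      mul_le_mul_of_nonneg_left hb (by positivity)
    refine lt_of_lt_of_le ?_ h3
    have e2 : (1 + t) ^ 2 * (1 - 2 * k * t) - 1
      = t * (2 * (1 - k) - t * (4 * k + 2 * k * t - 1)) := by ring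
    have h5 : k * t ≤ 1 := by nlinarith
    have h6 : t * (4 * k + 2 * k * t - 1) ≤ t * 5 :=
      mul_le_mul_of_nonneg_left (by linarith) ht0.le
    have : 0 < t * (2 * (1 - k) - t * (4 * k + 2 * k * t - 1)) :=
      mul_pos ht0 (by linarith)
    linarith

open scoped InnerProductSpace in
lemma john_core {d : ℕ} (Q : Set (EuclideanSpace ℝ (Fin d))) (hQ : Convex ℝ Q)
    (hQc : IsClosed Q) (c : EuclideanSpace ℝ (Fin d)) (hc : Metric.closedBall c 1 ⊆ Q)
    (hmax : ∀ (L : EuclideanSpace ℝ (Fin d) →ₗ[ℝ] EuclideanSpace ℝ (Fin d))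
      (v : EuclideanSpace ℝ (Fin d)), (∀ x, ‖x‖ ≤ 1 → v + L x ∈ Q) → |LinearMap.det L| ≤ 1) :
    Q ⊆ Metric.closedBall c d := by
  intro p hp
  rw [mem_closedBall_iff_norm]
  by_contra hlt
  push Not at hlt
  set w := p - c with hw
  set s := ‖w‖ with hs
  have hd : 1 ≤ d := by
    rcases Nat.eq_zero_or_pos d with h | h
    · subst h
      have : w = 0 := Subsingleton.elim _ _
      rw [hs, this] at hlt
      simp at hlt
    · exact h
  have hd' : (1 : ℝ) ≤ d := by exact_mod_cast hd
  have hs1 : 1 < s := by linarith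
  have hs0 : 0 < s := by linarith
  obtain ⟨t, ht0, ht1, hts, hvol⟩ := john_choose_t d s hd hlt
  set b2 : ℝ := 1 - 2 * t / (s - 1) with hb2
  have hb2pos : 0 < b2 := by
    have : 2 * t / (s - 1) < 1 := by rw [div_lt_one (by linarith)]; exact hts
    linarith
  set b := Real.sqrt b2 with hb
  have hbpos : 0 < b := Real.sqrt_pos.mpr hb2pos
  have hbsq : b ^ 2 = b2 := Real.sq_sqrt hb2pos.le
  set u : EuclideanSpace ℝ (Fin d) := s⁻¹ • w with hu
  have hun : ‖u‖ = 1 := by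
    rw [hu, norm_smul, Real.norm_of_nonneg (by positivity), ← hs]
    field_simp
  have huw : w = s • u := by rw [hu, smul_smul, mul_inv_cancel₀ hs0.ne', one_smul]
  have huu : ⟪u, u⟫_ℝ = 1 := by rw [real_inner_self_eq_norm_sq, hun]; norm_num
  clear_value u
  set a : ℝ := 1 + t with ha
  let f : EuclideanSpace ℝ (Fin d) →ₗ[ℝ] ℝ := ((a - b) / b) • (innerₗ _ u)
  let L : EuclideanSpace ℝ (Fin d) →ₗ[ℝ] EuclideanSpace ℝ (Fin d) :=
    b • LinearMap.transvection f u
  have hL : ∀ x, L x = b • x + ((a - b) * ⟪u, x⟫_ℝ) • u := by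
    intro x
    simp only [L, f, LinearMap.smul_apply, LinearMap.transvection.apply, innerₗ_apply_apply,
      smul_add, smul_smul, smul_eq_mul]
    congr 2
    field_simp
  have hdet : LinearMap.det L = b ^ (d - 1) * a := by
    have : LinearMap.det (LinearMap.transvection f u) = 1 + f u := LinearMap.transvection.det f u
    simp only [L]
    rw [LinearMap.det_smul, this, finrank_euclideanSpace_fin]
    simp only [f, LinearMap.smul_apply, innerₗ_apply_apply, huu, smul_eq_mul]
    obtain ⟨n, rfl⟩ : ∃ n, d = n + 1 := ⟨d - 1, by omega⟩
    simp only [Nat.add_sub_cancel, pow_succ]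
    field_simp
    ring
  have hle := hmax L (c + t • u) ?_
  · rw [hdet] at hle
    have h2 : (b ^ (d - 1) * a) ^ 2 ≤ 1 := by
      rw [← sq_abs]
      exact pow_le_one₀ (abs_nonneg _) hle
    have h3 : (b ^ (d - 1) * a) ^ 2 = a ^ 2 * b2 ^ (d - 1) := by
      rw [← hbsq]; ring
    linarith
  · intro x hx
    by_contra hz
    obtain ⟨g, r, hg1, hg2⟩ := geometric_hahn_banach_closed_point hQ hQc hz
    obtain ⟨y, rfl⟩ := (InnerProductSpace.toDual ℝ (EuclideanSpace ℝ (Fin d))).surjective g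
    simp only [InnerProductSpace.toDual_apply_apply] at hg1 hg2
    have hN : ⟪y, c⟫_ℝ + ‖y‖ < r := by
      have := hg1 (c + ‖y‖⁻¹ • y) (hc (by
        rw [mem_closedBall_iff_norm, add_sub_cancel_left, norm_smul, norm_inv, norm_norm]
        exact inv_mul_le_one))
      rw [inner_add_right, inner_smul_right, real_inner_self_eq_norm_sq] at this
      rcases eq_or_ne ‖y‖ 0 with h | h
      · rw [h] at this ⊢; simpa using this
      · have e : ‖y‖⁻¹ * ‖y‖ ^ 2 = ‖y‖ := by field_simp
        rwa [e] at this
    have hp2 : ⟪y, c⟫_ℝ + s * ⟪y, u⟫_ℝ < r := by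
      have := hg1 p hp
      have e : p = c + s • u := by rw [← huw, hw]; abel
      rwa [e, inner_add_right, inner_smul_right] at this
    set y1 := ⟪y, u⟫_ℝ with hy1
    set S := ‖b • y + ((a - b) * y1) • u‖ with hS
    have hS2 : S ^ 2 = b2 * ‖y‖ ^ 2 + (a ^ 2 - b2) * y1 ^ 2 := by
      rw [hS, norm_add_sq_real, norm_smul, norm_smul, hun, inner_smul_left, inner_smul_right,
        ← hy1, mul_pow, mul_pow, Real.norm_eq_abs, Real.norm_eq_abs, sq_abs, sq_abs, ← hbsq]
      simp
      ring
    have hyN : |y1| ≤ ‖y‖ := by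
      have := abs_real_inner_le_norm y u
      rwa [hun, mul_one] at this
    have hfin := john_real s t ‖y‖ y1 b2 S hs1 ht0 ht1 hts hb2 hyN (norm_nonneg _) hS2
    have hxS : ⟪y, L x⟫_ℝ ≤ S := by
      have e : ⟪y, L x⟫_ℝ = ⟪b • y + ((a - b) * y1) • u, x⟫_ℝ := by
        rw [hL, inner_add_right, inner_add_left, inner_smul_right, inner_smul_right,
          real_inner_smul_left, real_inner_smul_left, ← hy1]
        ring
      rw [e]
      refine (real_inner_le_norm _ _).trans ?_
      exact mul_le_of_le_one_right (norm_nonneg _) hx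
    rw [inner_add_right, inner_add_right, inner_smul_right, ← hy1] at hg2
    rcases max_cases ‖y‖ (s * y1) with ⟨h, _⟩ | ⟨h, _⟩ <;> rw [h] at hfin <;> linarith

lemma john_exists {d : ℕ} (P : Set (EuclideanSpace ℝ (Fin d)))
    (hPcomp : IsCompact P) (hPint : (interior P).Nonempty) :
    ∃ (T : EuclideanSpace ℝ (Fin d) →L[ℝ] EuclideanSpace ℝ (Fin d))
      (c : EuclideanSpace ℝ (Fin d)), (∀ x, ‖x‖ ≤ 1 → c + T x ∈ P) ∧ T.det ≠ 0 ∧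
      ∀ (L : EuclideanSpace ℝ (Fin d) →L[ℝ] EuclideanSpace ℝ (Fin d))
        (v : EuclideanSpace ℝ (Fin d)), (∀ x, ‖x‖ ≤ 1 → v + L x ∈ P) → |L.det| ≤ |T.det| := by
  let K : Set ((EuclideanSpace ℝ (Fin d) →L[ℝ] EuclideanSpace ℝ (Fin d)) ×
    EuclideanSpace ℝ (Fin d)) := {q | ∀ x, ‖x‖ ≤ 1 → q.2 + q.1 x ∈ P}
  have hKclosed : IsClosed K := by
    have : K = ⋂ x, ⋂ (_ : ‖x‖ ≤ 1), {q | q.2 + q.1 x ∈ P} := by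
      ext q; simp [K]
    rw [this]
    refine isClosed_iInter fun x => isClosed_iInter fun _ => ?_
    exact hPcomp.isClosed.preimage (by fun_prop)
  obtain ⟨R, hR⟩ := hPcomp.isBounded.exists_norm_le
  have hR0 : 0 ≤ R := by
    obtain ⟨z, hz⟩ := hPint
    exact (norm_nonneg z).trans (hR z (interior_subset hz))
  have hKb : Bornology.IsBounded K := by
    refine (Metric.isBounded_closedBall (x := 0) (r := 2 * R)).subset ?_
    rintro ⟨T, c⟩ hq
    rw [mem_closedBall_zero_iff, Prod.norm_def]
    have hc : ‖c‖ ≤ R := by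
      have := hR _ (hq 0 (by simp))
      simpa using this
    refine max_le ?_ (by simp only; linarith)
    refine T.opNorm_le_of_unit_norm (by linarith) fun x hx => ?_
    have h1 := hR _ (hq x hx.le)
    have : T x = (c + T x) - c := by abel
    rw [this]
    refine (norm_sub_le _ _).trans ?_
    simp only at h1
    linarith
  have hK : IsCompact K := Metric.isCompact_of_isClosed_isBounded hKclosed hKb
  obtain ⟨z, hz⟩ := hPint
  obtain ⟨ε, hε, hball⟩ := Metric.nhds_basis_closedBall.mem_iff.mp (mem_interior_iff_mem_nhds.mp hz)
  have hmem : ((ε • ContinuousLinearMap.id ℝ (EuclideanSpace ℝ (Fin d)), z) :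
      (EuclideanSpace ℝ (Fin d) →L[ℝ] EuclideanSpace ℝ (Fin d)) × EuclideanSpace ℝ (Fin d)) ∈ K := by
    intro x hx
    apply hball
    rw [mem_closedBall_iff_norm]
    simp [norm_smul, abs_of_pos hε]
    nlinarith
  obtain ⟨⟨T, c⟩, hTK, hTmax⟩ := hK.exists_isMaxOn ⟨_, hmem⟩
    (f := fun q => |q.1.det|)
    ((ContinuousLinearMap.continuous_det.comp continuous_fst).abs.continuousOn)
  refine ⟨T, c, hTK, ?_, fun L v h => hTmax (show (L, v) ∈ K from h)⟩
  have h1 := hTmax hmem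
  intro h0
  simp only [Set.mem_ofPred_eq, h0, abs_zero] at h1
  have h2 : (ε • ContinuousLinearMap.id ℝ (EuclideanSpace ℝ (Fin d))).det = ε ^ d := by
    simp [ContinuousLinearMap.det]
  rw [h2, abs_of_pos (by positivity)] at h1
  exact absurd h1 (not_le.mpr (by positivity))

theorem stmt9 {d : ℕ} (P : Set (EuclideanSpace ℝ (Fin d)))
    (hPconv : Convex ℝ P) (hPcomp : IsCompact P) (hPint : (interior P).Nonempty) :
    ∃ c ∈ P, ∃ F : EuclideanSpace ℝ (Fin d) ≃ᵃ[ℝ] EuclideanSpace ℝ (Fin d),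
      Metric.closedBall c 1 ⊆ F '' P ∧
      (∀ A : Set (EuclideanSpace ℝ (Fin d)), IsEllipsoid A → A ⊆ F '' P →
        MeasureTheory.volume A ≤ MeasureTheory.volume (Metric.closedBall c 1)) ∧
      F '' P ⊆ Metric.closedBall c d := by
  obtain ⟨T, c, hTP, hT0, hTmax⟩ := john_exists P hPcomp hPint
  have hcP : c ∈ P := by simpa using hTP 0 (by simp)
  let e : EuclideanSpace ℝ (Fin d) ≃ₗ[ℝ] EuclideanSpace ℝ (Fin d) :=
    LinearMap.equivOfDetNeZero (T : EuclideanSpace ℝ (Fin d) →ₗ[ℝ] EuclideanSpace ℝ (Fin d)) hT0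
  have he : ∀ x, e x = T x := fun x => rfl
  let G : EuclideanSpace ℝ (Fin d) ≃ᵃ[ℝ] EuclideanSpace ℝ (Fin d) :=
    e.toAffineEquiv.trans (AffineEquiv.constVAdd ℝ _ (c - T c))
  have hG : ∀ x, G x = c + T (x - c) := by
    intro x
    simp [G, he, map_sub]
    abel
  have hmem : ∀ z, z ∈ G.symm '' P ↔ G z ∈ P := by
    intro z
    constructor
    · rintro ⟨p, hp, rfl⟩; simpa using hp
    · intro h; exact ⟨G z, h, by simp⟩
  have hdet : ∀ (L : EuclideanSpace ℝ (Fin d) →ₗ[ℝ] EuclideanSpace ℝ (Fin d))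
      (v : EuclideanSpace ℝ (Fin d)), (∀ x, ‖x‖ ≤ 1 → v + L x ∈ G.symm '' P) →
      |LinearMap.det L| ≤ 1 := by
    intro L v h
    have h1 := hTmax (T ∘L (LinearMap.toContinuousLinearMap L)) (c + T (v - c)) (by
      intro x hx
      have := (hmem _).mp (h x hx)
      rw [hG] at this
      convert this using 1
      simp [map_sub, map_add]
      abel)
    have h2 : (T ∘L (LinearMap.toContinuousLinearMap L)).det = T.det * LinearMap.det L := by
      simp only [ContinuousLinearMap.det]
      rw [← LinearMap.det_comp]
      rfl
    rw [h2, abs_mul] at h1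
    exact (mul_le_iff_le_one_right (abs_pos.mpr hT0)).mp h1
  have hball : Metric.closedBall c 1 ⊆ G.symm '' P := by
    intro z hz
    rw [hmem, hG]
    exact hTP _ (by rwa [mem_closedBall_iff_norm] at hz)
  refine ⟨c, hcP, G.symm, hball, ?_, ?_⟩
  · rintro A ⟨f, rfl⟩ hA
    have hf : ∀ x, f x = f 0 + f.linear x := by
      intro x
      have := f.map_vadd 0 x
      simp at this
      rw [this]; abel
    have h1 := hdet (f.linear : EuclideanSpace ℝ (Fin d) →ₗ[ℝ] EuclideanSpace ℝ (Fin d)) (f 0) (by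
      intro x hx
      have := hA ⟨x, by simpa using hx, rfl⟩
      rw [hf] at this
      exact this)
    have h2 : f '' Metric.closedBall 0 1 = (fun x => f 0 + x) ''
        ((f.linear : EuclideanSpace ℝ (Fin d) →ₗ[ℝ] EuclideanSpace ℝ (Fin d)) ''
          Metric.closedBall 0 1) := by
      rw [Set.image_image]
      exact Set.image_congr fun x _ => hf x
    rw [h2, Set.image_add_left, MeasureTheory.measure_preimage_add,
      MeasureTheory.Measure.addHaar_image_linearMap,
      MeasureTheory.Measure.addHaar_closedBall_center _ c]
    exact mul_le_of_le_one_left (by positivity) (by simpa using h1)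
  · refine john_core _ ?_ ?_ c hball hdet
    · exact hPconv.affine_image (G.symm : EuclideanSpace ℝ (Fin d) →ᵃ[ℝ] EuclideanSpace ℝ (Fin d))
    · refine (hPcomp.image ?_).isClosed
      exact (G.symm : EuclideanSpace ℝ (Fin d) →ᵃ[ℝ] EuclideanSpace ℝ (Fin d)).continuous_of_finiteDimensional
end
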